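/- Let T be a Grothendieck site such that Shv(T) is replete, and let (P_n)_{n∈ℕ} be an inverse system of multiplicative presheaves of sets on T. Then the natural map (lim_n P_n)^♯ → lim_n P_n^♯ from the sheafification of the inverse limit to the inverse limit of the sheafifications is an isomorphism. -/

import Mathlib

open CategoryTheory Limits Opposite

universe u

variable {C : Type u} [SmallCategory C]

/-- A presheaf `P` on a Grothendieck site is *multiplicative* if for every set-indexed
family `{X_j}` of objects, the natural map
`Hom((∐_j h_{X_j})^♯, P) → Hom(∐_j h_{X_j}, P) ≅ ∏_j P(X_j)` is a bijection. -/
def IsMultiplicative (J : GrothendieckTopology C) (P : Cᵒᵖ ⥤ Type u) : Prop :=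
  ∀ (ι : Type u) (X : ι → C),
    Function.Bijective
      (fun (g : sheafify J (∐ fun j => yoneda.obj (X j)) ⟶ P) (j : ι) =>
        yonedaEquiv
          (Sigma.ι (fun j => yoneda.obj (X j)) j ≫
            toSheafify J (∐ fun j => yoneda.obj (X j)) ≫ g))

/-- A category (e.g. a 1-topos) is *replete* if for every `ℕ`-indexed inverse system
in which all transition maps are epimorphisms, the projections from the inverse limit
are epimorphisms. -/
def IsReplete (D : Type*) [CategoryTheory.Category D]
    [HasLimitsOfShape ℕᵒᵖ D] : Prop :=
  ∀ F : ℕᵒᵖ ⥤ D,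
    (∀ n : ℕ, Epi (F.map (homOfLE (Nat.le_succ n)).op)) →
    ∀ n : ℕ, Epi (limit.π F (op n))

namespace IsMultiplicative

variable (J : GrothendieckTopology C)

/-- The sheafification maps of coproducts of representable presheaves. -/
def coproductUnits : MorphismProperty (Cᵒᵖ ⥤ Type u) :=
  MorphismProperty.ofHoms fun x : Σ ι : Type u, ι → C =>
    toSheafify J (∐ fun j => yoneda.obj (x.2 j))

variable {J}

lemma iff_isLocal (P : Cᵒᵖ ⥤ Type u) :
    IsMultiplicative J P ↔ (coproductUnits J).isLocal P := by
  have key (ι : Type u) (X : ι → C) :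
      Function.Bijective (fun (g : (∐ fun j => yoneda.obj (X j)) ⟶ P) (j : ι) =>
        yonedaEquiv (Sigma.ι (fun j => yoneda.obj (X j)) j ≫ g)) := by
    refine ⟨fun g g' h => Sigma.hom_ext _ _ fun j => yonedaEquiv.injective (congrFun h j),
      fun t => ⟨Sigma.desc fun j => yonedaEquiv.symm (t j), ?_⟩⟩
    funext j
    simp
  constructor
  · rintro h _ _ _ ⟨⟨ι, X⟩⟩
    exact (Function.Bijective.of_comp_iff' (key ι X) _).1 (h ι X)
  · intro h ι X
    exact (key ι X).comp (h _ (MorphismProperty.ofHoms.mk (⟨ι, X⟩ : Σ ι : Type u, ι → C)))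

lemma of_isLimit {K : Type*} [Category K] {F : K ⥤ Cᵒᵖ ⥤ Type u} {c : Cone F}
    (hc : IsLimit c) (hF : ∀ k, IsMultiplicative J (F.obj k)) : IsMultiplicative J c.pt := by
  simp only [iff_isLocal] at *
  exact (coproductUnits J).isLocal.prop_of_isLimit hc hF

lemma of_isPullback {P X Y Z : Cᵒᵖ ⥤ Type u} {fst : P ⟶ X} {snd : P ⟶ Y} {f : X ⟶ Z}
    {g : Y ⟶ Z} (h : IsPullback fst snd f g) (hX : IsMultiplicative J X)
    (hY : IsMultiplicative J Y) (hZ : IsMultiplicative J Z) : IsMultiplicative J P :=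
  of_isLimit h.isLimit (by rintro (_ | _ | _) <;> assumption)

lemma of_isSheaf {P : Cᵒᵖ ⥤ Type u} (hP : Presheaf.IsSheaf J P) : IsMultiplicative J P := by
  rw [iff_isLocal]
  rintro _ _ _ ⟨x⟩
  exact J.W_toSheafify _ _ hP

end IsMultiplicative

section Tower

variable (J : GrothendieckTopology C)

/-- The coproduct of representables indexed by all sections of `G`. -/
noncomputable abbrev freeCover (G : Cᵒᵖ ⥤ Type u) : Cᵒᵖ ⥤ Type u :=
  ∐ fun e : Σ U : C, G.obj (op U) => yoneda.obj e.1

/-- The tautological map from the free cover. -/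
noncomputable def freeCoverπ (G : Cᵒᵖ ⥤ Type u) : freeCover G ⟶ G :=
  Sigma.desc fun e => yonedaEquiv.symm e.2

instance (G : Cᵒᵖ ⥤ Type u) : Epi (freeCoverπ G) := by
  refine ⟨fun {Z} g h e => ?_⟩
  ext U x
  have := Sigma.ι (fun e : Σ U : C, G.obj (op U) => yoneda.obj e.1) ⟨U.unop, x⟩ ≫= e
  rw [freeCoverπ, Sigma.ι_desc_assoc, Sigma.ι_desc_assoc] at this
  have := congrArg yonedaEquiv this
  rwa [yonedaEquiv_comp, yonedaEquiv_comp, Equiv.apply_symm_apply] at this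

lemma IsMultiplicative.bijective_toSheafify_freeCover_comp {P : Cᵒᵖ ⥤ Type u}
    (hP : IsMultiplicative J P) (G : Cᵒᵖ ⥤ Type u) :
    Function.Bijective (fun g : sheafify J (freeCover G) ⟶ P =>
      toSheafify J (freeCover G) ≫ g) :=
  (IsMultiplicative.iff_isLocal P).1 hP _
    (MorphismProperty.ofHoms.mk
      (⟨(Σ U : C, G.obj (op U)), fun e => e.1⟩ : Σ ι : Type u, ι → C))

variable (E : ℕᵒᵖ ⥤ Cᵒᵖ ⥤ Type u)

/-- Iterated pullbacks of free covers along the transition maps of a tower. -/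
noncomputable def coverStage : (n : ℕ) → Over (E.obj (op n))
  | 0 => Over.mk (𝟙 _)
  | n + 1 => Over.mk (pullback.fst (E.map (homOfLE (Nat.le_succ n)).op)
      (freeCoverπ (coverStage n).left ≫ (coverStage n).hom))

/-- The transition maps of the tower of free covers. -/
noncomputable def coverTransition (n : ℕ) :
    freeCover (coverStage E (n + 1)).left ⟶ freeCover (coverStage E n).left :=
  freeCoverπ _ ≫ pullback.snd (E.map (homOfLE (Nat.le_succ n)).op)
      (freeCoverπ (coverStage E n).left ≫ (coverStage E n).hom)

/-- A tower of coproducts of representables covering a given tower. -/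
noncomputable def coverTower : ℕᵒᵖ ⥤ Cᵒᵖ ⥤ Type u :=
  Functor.ofOpSequence (X := fun n => freeCover (coverStage E n).left) (coverTransition E)

/-- The map from the tower of free covers to the original tower. -/
noncomputable def coverTowerπ : coverTower E ⟶ E :=
  NatTrans.ofOpSequence (fun n => freeCoverπ _ ≫ (coverStage E n).hom) fun n => by
    have h : (coverTower E).map (homOfLE (Nat.le_add_right n 1)).op = coverTransition E n :=
      Functor.ofOpSequence_map_homOfLE_succ _ n
    rw [h]
    exact (Category.assoc _ _ _).trans ((congrArg (freeCoverπ _ ≫ ·)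
      pullback.condition.symm).trans (Category.assoc _ _ _).symm)

lemma epi_coverTower_map (n : ℕ)
    (hE : J.W (E.map (homOfLE (Nat.le_succ n)).op)) :
    Epi ((coverTower E ⋙ presheafToSheaf J (Type u)).map (homOfLE (Nat.le_succ n)).op) := by
  rw [J.W_iff] at hE
  have h := (IsPullback.of_hasPullback (E.map (homOfLE (Nat.le_succ n)).op)
      (freeCoverπ (coverStage E n).left ≫ (coverStage E n).hom)).map
      (presheafToSheaf J (Type u))
  have := h.isIso_snd_of_isIso
  have e : (coverTower E).map (homOfLE (Nat.le_succ n)).op = coverTransition E n :=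
    Functor.ofOpSequence_map_homOfLE_succ _ n
  rw [Functor.comp_map, e]
  change Epi ((presheafToSheaf J (Type u)).map (freeCoverπ (pullback _ _) ≫ pullback.snd _ _))
  rw [Functor.map_comp]
  exact epi_comp' inferInstance (@IsIso.epi_of_iso _ _ _ _ _ this)

variable {J E}

/-- A map from a sheafified tower of free covers extending a map to a multiplicative tower. -/
lemma exists_sheafify_coverTower_lift (hE : ∀ n : ℕ, IsMultiplicative J (E.obj (op n))) :
    ∃ ψ : coverTower E ⋙ sheafification J (Type u) ⟶ E,
      ∀ n, toSheafify J _ ≫ ψ.app n = (coverTowerπ E).app n := by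
  have hb {m n : ℕᵒᵖ} : Function.Bijective
      (fun g : sheafify J ((coverTower E).obj m) ⟶ E.obj n => toSheafify J _ ≫ g) :=
    (hE n.unop).bijective_toSheafify_freeCover_comp J (coverStage E m.unop).left
  choose ψ hψ using fun n : ℕᵒᵖ => hb.2 ((coverTowerπ E).app n)
  dsimp only at hψ
  refine ⟨⟨ψ, fun m n f => hb.1 ?_⟩, hψ⟩
  change toSheafify J _ ≫ sheafifyMap J _ ≫ ψ n = toSheafify J _ ≫ ψ m ≫ _
  rw [reassoc_of% hψ m, ← toSheafify_naturality_assoc, hψ n, NatTrans.naturality]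

/-- In a replete topos, the limit of a tower of multiplicative presheaves with locally
bijective transition maps covers its bottom stage. -/
lemma exists_cover_of_tower (hrep : IsReplete (Sheaf J (Type u)))
    (hE : ∀ n : ℕ, IsMultiplicative J (E.obj (op n)))
    (hW : ∀ n : ℕ, J.W (E.map (homOfLE (Nat.le_succ n)).op)) :
    ∃ (Z : Cᵒᵖ ⥤ Type u) (r : (Functor.const _).obj Z ⟶ E),
      Epi ((presheafToSheaf J (Type u)).map (r.app (op 0))) := by
  obtain ⟨ψ, hψ⟩ := exists_sheafify_coverTower_lift hE
  let D := coverTower E ⋙ presheafToSheaf J (Type u)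
  have : Epi (limit.π D (op 0)) := hrep D (fun n => epi_coverTower_map J E n (hW n)) 0
  refine ⟨(limit D).obj, ((sheafToPresheaf J (Type u)).mapCone (limit.cone D)).π ≫ ψ, ?_⟩
  change Epi ((presheafToSheaf J (Type u)).map
    ((sheafToPresheaf J (Type u)).map (limit.π D (op 0)) ≫ ψ.app (op 0)))
  have e₁ : Epi ((presheafToSheaf J (Type u)).map
      ((sheafToPresheaf J (Type u)).map (limit.π D (op 0)))) :=
    ((MorphismProperty.epimorphisms _).arrow_mk_iso_iff
      (Arrow.isoMk ((sheafificationNatIso J (Type u)).app _)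
        ((sheafificationNatIso J (Type u)).app _)
        ((sheafificationNatIso J (Type u)).hom.naturality (limit.π D (op 0))).symm)).1 this
  have e₂ : Epi ((presheafToSheaf J (Type u)).map (ψ.app (op 0))) := by
    have h : (coverTowerπ E).app (op 0) = freeCoverπ _ := by
      change freeCoverπ _ ≫ 𝟙 _ = _
      exact Category.comp_id _
    have : Epi ((presheafToSheaf J (Type u)).map ((coverTowerπ E).app (op 0))) := by
      rw [h]
      exact inferInstanceAs
        (Epi ((presheafToSheaf J (Type u)).map (freeCoverπ (coverStage E 0).left)))
    rw [← hψ, Functor.map_comp] at this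
    exact @epi_of_epi _ _ _ _ _ _ _ this
  rw [Functor.map_comp]
  exact epi_comp' e₁ e₂

/-- Local sections lift along pointwise locally bijective maps of multiplicative towers. -/
lemma exists_lift_of_tower (hrep : IsReplete (Sheaf J (Type u)))
    {A B : ℕᵒᵖ ⥤ Cᵒᵖ ⥤ Type u} {Q : Cᵒᵖ ⥤ Type u}
    (hA : ∀ n : ℕ, IsMultiplicative J (A.obj (op n)))
    (hB : ∀ n : ℕ, IsMultiplicative J (B.obj (op n))) (hQ : IsMultiplicative J Q)
    (w : A ⟶ B) (hw : ∀ n : ℕ, J.W (w.app (op n))) (q : (Functor.const _).obj Q ⟶ B) :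
    ∃ (Z : Cᵒᵖ ⥤ Type u) (p : Z ⟶ Q) (r : (Functor.const _).obj Z ⟶ A),
      r ≫ w = (Functor.const _).map p ≫ q ∧
      Epi ((presheafToSheaf J (Type u)).map p) := by
  have hpb (n : ℕ) := (IsPullback.of_hasPullback w q).map ((evaluation _ _).obj (op n))
  have hsnd (n : ℕ) : J.W ((pullback.snd w q).app (op n)) := by
    have h := (hpb n).map (presheafToSheaf J (Type u))
    have : IsIso ((presheafToSheaf J (Type u)).map
        (((evaluation _ _).obj (op n)).map w)) := (J.W_iff _).1 (hw n)
    exact (J.W_iff _).2 h.isIso_snd_of_isIso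
  obtain ⟨Z, r, hr⟩ := exists_cover_of_tower (E := pullback w q) hrep
    (fun n => .of_isPullback (hpb n) (hA n) hQ (hB n)) (fun n => by
      refine J.W.of_postcomp _ _ (hsnd n) ?_
      rw [(pullback.snd w q).naturality]
      exact J.W.comp_mem _ _ (hsnd (n + 1)) (J.W.id_mem _))
  refine ⟨Z, r.app (op 0) ≫ (pullback.snd w q).app (op 0), r ≫ pullback.fst w q, ?_, ?_⟩
  · rw [Category.assoc, pullback.condition, ← Category.assoc]
    congr 1
    ext1
    ext1 n
    have := (r ≫ pullback.snd w q).naturality (homOfLE (Nat.zero_le n.unop)).op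
    simpa using this.symm
  · have := (J.W_iff _).1 (hsnd 0)
    rw [Functor.map_comp]
    exact epi_comp' hr inferInstance

end Tower

section Comparison

variable {J : GrothendieckTopology C} {P : ℕᵒᵖ ⥤ Cᵒᵖ ⥤ Type u}

variable (J P) in
/-- The map from the limit presheaf to the limit of the sheafifications. -/
noncomputable def limitToSheaf :
    limit P ⟶ (limit (P ⋙ presheafToSheaf J (Type u))).obj :=
  (sheafificationAdjunction J (Type u)).homEquiv _ _ (limit.post P (presheafToSheaf J (Type u)))

lemma limitToSheaf_π (n : ℕᵒᵖ) :
    limitToSheaf J P ≫ (limit.π (P ⋙ presheafToSheaf J (Type u)) n).hom =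
      limit.π P n ≫ toSheafify J (P.obj n) := by
  have := (sheafificationAdjunction J (Type u)).homEquiv_naturality_right
    (limit.post P (presheafToSheaf J (Type u))) (limit.π (P ⋙ presheafToSheaf J (Type u)) n)
  rw [limit.post_π] at this
  refine this.symm.trans ?_
  rw [Adjunction.homEquiv_unit]
  exact ((sheafificationAdjunction J (Type u)).unit.naturality _).symm

lemma limitToSheaf_hom_ext {Z : Cᵒᵖ ⥤ Type u}
    {f g : Z ⟶ (limit (P ⋙ presheafToSheaf J (Type u))).obj}
    (h : ∀ n, f ≫ (limit.π (P ⋙ presheafToSheaf J (Type u)) n).hom =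
      g ≫ (limit.π (P ⋙ presheafToSheaf J (Type u)) n).hom) : f = g :=
  (isLimitOfPreserves (sheafToPresheaf J (Type u))
    (limit.isLimit (P ⋙ presheafToSheaf J (Type u)))).hom_ext h

lemma epi_map_limitToSheaf (hrep : IsReplete (Sheaf J (Type u)))
    (hP : ∀ n : ℕ, IsMultiplicative J (P.obj (op n))) :
    Epi ((presheafToSheaf J (Type u)).map (limitToSheaf J P)) := by
  obtain ⟨Z, p, r, h, hp⟩ := exists_lift_of_tower hrep (A := P)
    (B := P ⋙ sheafification J (Type u)) hP (fun n => .of_isSheaf (ObjectProperty.FullSubcategory.property _))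
    (.of_isSheaf (ObjectProperty.FullSubcategory.property (limit (P ⋙ presheafToSheaf J (Type u)))))
    (Functor.whiskerLeft P (toSheafification J (Type u)))
    (fun n => J.W_toSheafify _)
    ((sheafToPresheaf J (Type u)).mapCone (limit.cone (P ⋙ presheafToSheaf J (Type u)))).π
  have e : limit.lift P ⟨Z, r⟩ ≫ limitToSheaf J P = p := by
    refine limitToSheaf_hom_ext fun n => ?_
    rw [Category.assoc, limitToSheaf_π, limit.lift_π_assoc]
    exact NatTrans.congr_app h n
  rw [← e, Functor.map_comp] at hp
  exact @epi_of_epi _ _ _ _ _ _ _ hp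

lemma mono_map_limitToSheaf (hrep : IsReplete (Sheaf J (Type u)))
    (hP : ∀ n : ℕ, IsMultiplicative J (P.obj (op n))) :
    Mono ((presheafToSheaf J (Type u)).map (limitToSheaf J P)) := by
  let t : P ⟶ P ⋙ sheafification J (Type u) :=
    Functor.whiskerLeft P (toSheafification J (Type u))
  have hQ := IsPullback.of_hasPullback (limitToSheaf J P) (limitToSheaf J P)
  have hB (n : ℕ) := (IsPullback.of_hasPullback t t).map ((evaluation _ _).obj (op n))
  have hlim : IsMultiplicative J (limit P) := .of_isLimit (limit.isLimit P) fun n => hP n.unop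
  have hfst (n : ℕ) : J.W ((pullback.fst t t).app (op n)) := by
    have h := (hB n).map (presheafToSheaf J (Type u))
    have : IsIso ((presheafToSheaf J (Type u)).map (((evaluation _ _).obj (op n)).map t)) :=
      (J.W_iff _).1 (J.W_toSheafify _)
    exact (J.W_iff _).2 h.isIso_fst_of_isIso
  let x := pullback.fst (limitToSheaf J P) (limitToSheaf J P)
  let y := pullback.snd (limitToSheaf J P) (limitToSheaf J P)
  obtain ⟨Z, p, r, h, hp⟩ := exists_lift_of_tower hrep (A := P) (B := pullback t t) hP
    (fun n => .of_isPullback (hB n) (hP n) (hP n) (.of_isSheaf (ObjectProperty.FullSubcategory.property _)))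
    (.of_isPullback hQ hlim hlim (.of_isSheaf (ObjectProperty.FullSubcategory.property _)))
    (pullback.diagonal t) (fun n => by
      refine J.W.of_postcomp _ _ (hfst n) ?_
      rw [← NatTrans.comp_app, pullback.diagonal_fst]
      exact J.W.id_mem _)
    (pullback.lift ((Functor.const _).map x ≫ (limit.cone P).π)
      ((Functor.const _).map y ≫ (limit.cone P).π) (by
        ext1
        ext1 n
        change (x ≫ limit.π P n) ≫ toSheafify J _ = (y ≫ limit.π P n) ≫ toSheafify J _
        simp only [Category.assoc, ← limitToSheaf_π]
        rw [reassoc_of% (pullback.condition : x ≫ limitToSheaf J P = y ≫ _)]))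
  have e : p ≫ x = p ≫ y := by
    refine limit.hom_ext fun n => ?_
    have h₁ := NatTrans.congr_app (h =≫ pullback.fst t t) n
    have h₂ := NatTrans.congr_app (h =≫ pullback.snd t t) n
    simp only [Category.assoc, pullback.diagonal_fst, pullback.diagonal_snd, pullback.lift_fst,
      pullback.lift_snd] at h₁ h₂
    simpa using h₁.symm.trans h₂
  refine IsKernelPair.mono_of_eq_fst_snd (hQ.map (presheafToSheaf J (Type u))) ?_
  rw [← cancel_epi ((presheafToSheaf J (Type u)).map p), ← Functor.map_comp, ← Functor.map_comp]
  exact congrArg _ e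

end Comparison

/-- If `Shv(T)` is replete, sheafification commutes with `ℕ`-indexed inverse limits of
multiplicative presheaves: the canonical comparison map
`(lim_n P_n)^♯ → lim_n P_n^♯` is an isomorphism. -/
theorem stmt_8 (J : GrothendieckTopology C) (hrep : IsReplete (Sheaf J (Type u)))
    (P : ℕᵒᵖ ⥤ Cᵒᵖ ⥤ Type u) (hP : ∀ n : ℕ, IsMultiplicative J (P.obj (op n))) :
    IsIso (limit.post P (presheafToSheaf J (Type u))) := by
  have := epi_map_limitToSheaf hrep hP
  have := mono_map_limitToSheaf hrep hP
  have : IsIso ((presheafToSheaf J (Type u)).map (limitToSheaf J P)) := isIso_of_mono_of_epi _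
  have e : limit.post P (presheafToSheaf J (Type u)) =
      (presheafToSheaf J (Type u)).map (limitToSheaf J P) ≫
        (sheafificationAdjunction J (Type u)).counit.app _ := by
    exact ((Equiv.symm_apply_apply _ _).symm.trans
      ((sheafificationAdjunction J (Type u)).homEquiv_counit ..))
  rw [e]
  infer_instance
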